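/- For every integer c ≥ 0 and every real number δ > 0 there exists a natural number N(c,δ) with the following property: for every integer d ≥ N(c,δ) and every finite permutation group G ≤ Sym(Ω) of degree n = |Ω| such that the setwise stabilizer G_Δ lies in the class Γ_d for every subset Δ ⊆ Ω of size c, one has |G| ≤ ((1+δ)·d/e)^{n-1}, where e denotes Euler's number. -/

import Mathlib

open scoped Pointwise

/-- A group `H` has a *section* isomorphic to the alternating group `A_d`, i.e. there are
subgroups `K ⊴ L ≤ H` with `L/K ≅ A_d`; equivalently, there is a subgroup `L ≤ H` and a
surjective homomorphism from `L` onto `A_d`. -/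
def HasAltSection (d : ℕ) (H : Type*) [Group H] : Prop :=
  ∃ (L : Subgroup H) (φ : ↥L →* alternatingGroup (Fin d)), Function.Surjective φ

/-- The class `Γ_d`: groups with no section isomorphic to the alternating group `A_d`. -/
def InGamma (d : ℕ) (H : Type*) [Group H] : Prop := ¬ HasAltSection d H

/-- A permutation group `G ≤ Sym(Ω)` is primitive if it acts transitively on `Ω` and
every block of the action is trivial (i.e. it preserves no nontrivial partition of `Ω`). -/
def IsPrimitivePerm {Ω : Type*} (G : Subgroup (Equiv.Perm Ω)) : Prop :=
  MulAction.IsPretransitive G Ω ∧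
    ∀ B : Set Ω, MulAction.IsBlock G B → MulAction.IsTrivialBlock B

/-- `G ≤ Sym(Ω)` has a base of size at most `k`: a subset of `Ω` of cardinality at most `k`
whose pointwise stabilizer in `G` is trivial.  The base size `b(G)` is the least such `k`,
so `b(G) ≤ k` is expressed by `HasBaseOfSize G k`. -/
def HasBaseOfSize {Ω : Type*} (G : Subgroup (Equiv.Perm Ω)) (k : ℕ) : Prop :=
  ∃ S : Finset Ω, S.card ≤ k ∧ ∀ g ∈ G, (∀ α ∈ S, g α = α) → g = 1

/-- The pointwise stabilizer `G_(Δ) = ⋂_{α ∈ Δ} G_α` of a subset `Δ ⊆ Ω` in `G ≤ Sym(Ω)`,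
as a subgroup of `G` (equal to `G` itself when `Δ` is empty). -/
def PointwiseStab {Ω : Type*} (G : Subgroup (Equiv.Perm Ω)) (Δ : Finset Ω) : Subgroup ↥G :=
  ⨅ α ∈ Δ, MulAction.stabilizer (↥G) α

open Equiv

section AlternatingSections

variable {d : ℕ} {A B : Type*} [Group A] [Group B]

theorem InGamma.of_injective (hB : InGamma d B) (f : A →* B) (hf : Function.Injective f) :
    InGamma d A := by
  rintro ⟨L, φ, hφ⟩
  refine hB ⟨L.map f, φ.comp (L.equivMapOfInjective f hf).symm.toMonoidHom, ?_⟩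
  exact hφ.comp (L.equivMapOfInjective f hf).symm.surjective

theorem InGamma.of_surjective (hA : InGamma d A) (f : A →* B) (hf : Function.Surjective f) :
    InGamma d B := by
  rintro ⟨L, φ, hφ⟩
  exact hA ⟨L.comap f, φ.comp (f.subgroupComap L),
    hφ.comp (f.subgroupComap_surjective_of_surjective L hf)⟩

theorem InGamma.range (hA : InGamma d A) (f : A →* B) : InGamma d f.range :=
  hA.of_surjective f.rangeRestrict f.rangeRestrict_surjective

end AlternatingSections

/-- The alternating group on at least `d` points has a section isomorphic to `A_d`. -/
theorem InGamma.not_alternatingGroup_le {X : Type*} [Fintype X] [DecidableEq X] {d : ℕ}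
    {G : Subgroup (Perm X)} (hG : InGamma d G) (hd : d ≤ Fintype.card X) :
    ¬ alternatingGroup X ≤ G := by
  intro hle
  obtain ⟨ι⟩ : Nonempty (Fin d ↪ X) := Function.Embedding.nonempty_of_card_le (by simpa using hd)
  let e : Fin d ≃ {x // x ∈ Set.range ι} := Equiv.ofInjective ι ι.injective
  have hmem : ∀ σ : alternatingGroup (Fin d),
      (Perm.extendDomainHom e).comp (alternatingGroup (Fin d)).subtype σ ∈ G := by
    intro σ
    apply hle
    have h := Perm.mem_alternatingGroup.mp σ.2
    simp [Perm.mem_alternatingGroup, Perm.extendDomainHom, Perm.sign_extendDomain, h]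
  have hinj : Function.Injective
      (((Perm.extendDomainHom e).comp (alternatingGroup (Fin d)).subtype).codRestrict G hmem) :=
    (MonoidHom.injective_codRestrict _ _ _).mpr
      ((Perm.extendDomainHom_injective e).comp Subtype.val_injective)
  refine hG.of_injective _ hinj ⟨⊤, Subgroup.topEquiv.toMonoidHom, ?_⟩
  exact Subgroup.topEquiv.surjective

/-- If the supports of `g` and `h` meet only in `a`, then the commutator of `g` and `h` is a
three-cycle. -/
theorem isThreeCycle_commutator {X : Type*} [Fintype X] [DecidableEq X] {g h : Perm X} {a : X}
    (hga : g a ≠ a) (hha : h a ≠ a) (hgh : ∀ x, x ≠ a → g x = x ∨ h x = x) :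
    (g * h * g⁻¹ * h⁻¹).IsThreeCycle := by
  have hgha : g (h a) = h a := (hgh _ hha).resolve_right fun e => hha (h.injective e)
  have hhga : h (g a) = g a := (hgh _ hga).resolve_left fun e => hga (g.injective e)
  have hne : h a ≠ g a := by
    intro e
    rw [e] at hgha
    exact hga (g.injective hgha)
  have key : g * h * g⁻¹ * h⁻¹ = swap a (h a) * swap a (g a) := by
    rw [mul_inv_eq_iff_eq_mul, mul_inv_eq_iff_eq_mul]
    ext x
    simp only [Perm.mul_apply]
    by_cases hxa : x = a
    · rw [hxa, hgha, hhga, swap_apply_right, swap_apply_left]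
    rcases hgh x hxa with hx | hx
    · rw [hx]
      by_cases h2 : h x = a
      · rw [h2, swap_apply_left, swap_apply_of_ne_of_ne hga hne.symm]
      · have hfix : g (h x) = h x := by
          rcases hgh _ h2 with e | e
          · exact e
          · rw [h.injective e, hx]
        have h3 : h x ≠ g a := by
          intro e
          rw [← hhga] at e
          rw [h.injective e] at hx
          exact hga (g.injective hx)
        rw [hfix, swap_apply_of_ne_of_ne h2 h3,
          swap_apply_of_ne_of_ne h2 fun e => hxa (h.injective e)]
    · rw [hx]
      by_cases h2 : g x = a
      · rw [h2, swap_apply_of_ne_of_ne hha hne, swap_apply_right]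
      · have hfix : h (g x) = g x := by
          rcases hgh _ h2 with e | e
          · rw [g.injective e, hx]
          · exact e
        have h3 : g x ≠ h a := by
          intro e
          rw [← hgha] at e
          rw [g.injective e] at hx
          exact hha (h.injective hx)
        rw [hfix, swap_apply_of_ne_of_ne h2 fun e => hxa (g.injective e),
          swap_apply_of_ne_of_ne h2 h3]
  rw [key]
  exact Perm.isThreeCycle_swap_mul_swap_same hha.symm hga.symm hne

/-- **Bochert's argument**: a primitive group not containing the alternating group has a base
consisting of at most half of the points. -/
theorem exists_base_of_isPreprimitive {X : Type*} [Fintype X] [DecidableEq X]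
    {G : Subgroup (Perm X)} (hG : MulAction.IsPreprimitive G X) (hA : ¬ alternatingGroup X ≤ G) :
    HasBaseOfSize G (Fintype.card X / 2) := by
  classical
  let base : Finset X → Prop := fun S => ∀ g ∈ G, (∀ x ∈ S, g x = x) → g = 1
  have huniv : base Finset.univ := fun g _ hg => Perm.ext fun x => hg x (Finset.mem_univ x)
  obtain ⟨S, hS, hmin⟩ := Set.exists_min_image {S | base S} Finset.card (Set.toFinite _)
    ⟨_, huniv⟩
  refine ⟨S, ?_, hS⟩
  by_contra! hlt
  have hcompl : ¬ base Sᶜ := by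
    intro h
    have := hmin _ h
    rw [Finset.card_compl] at this
    omega
  obtain ⟨g, hgG, hgfix, hg1⟩ : ∃ g ∈ G, (∀ x ∈ Sᶜ, g x = x) ∧ g ≠ 1 := by
    simpa [base] using hcompl
  obtain ⟨a, ha⟩ : ∃ a, g a ≠ a := by
    by_contra! h
    exact hg1 (Perm.ext h)
  have haS : a ∈ S := by
    by_contra h
    exact ha (hgfix a (by simpa using h))
  have herase : ¬ base (S.erase a) := fun h =>
    (hmin _ h).not_gt (Finset.card_erase_lt_of_mem haS)
  obtain ⟨h, hhG, hhfix, hh1⟩ : ∃ h ∈ G, (∀ x ∈ S.erase a, h x = x) ∧ h ≠ 1 := by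
    simpa [base] using herase
  have hha : h a ≠ a := by
    intro e
    refine hh1 (hS h hhG fun x hx => ?_)
    by_cases hxa : x = a
    · rw [hxa, e]
    · exact hhfix x (Finset.mem_erase.mpr ⟨hxa, hx⟩)
  have h3 := isThreeCycle_commutator ha hha fun x hxa => by
    by_cases hx : x ∈ S
    · exact .inr (hhfix x (Finset.mem_erase.mpr ⟨hxa, hx⟩))
    · exact .inl (hgfix x (by simpa using hx))
  exact hA (Perm.alternatingGroup_le_of_isPreprimitive_of_isThreeCycle_mem hG h3
    (G.mul_mem (G.mul_mem (G.mul_mem hgG hhG) (G.inv_mem hgG)) (G.inv_mem hhG)))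

/-- A permutation group all of whose invariant equivalence relations are trivial is primitive or
trivial. -/
theorem isPreprimitive_of_invariant_setoid {X : Type*} (G : Subgroup (Perm X)) (hG : G ≠ ⊥)
    (h : ∀ r : Setoid X, (∀ g ∈ G, ∀ x y, r x y → r (g x) (g y)) → r = ⊥ ∨ r = ⊤) :
    MulAction.IsPreprimitive G X := by
  have htrans : MulAction.IsPretransitive G X := by
    rcases h (MulAction.orbitRel G X) (by
      rintro g hg x y ⟨k, rfl⟩
      refine ⟨⟨g, hg⟩ * k * ⟨g, hg⟩⁻¹, ?_⟩
      simp [Subgroup.smul_def]) with hr | hr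
    · refine absurd ((Subgroup.eq_bot_iff_forall G).mpr fun g hg => Perm.ext fun x => ?_) hG
      have : (MulAction.orbitRel G X) (g x) x := ⟨⟨g, hg⟩, rfl⟩
      rw [hr] at this
      exact this
    · refine ⟨fun x y => ?_⟩
      have : (MulAction.orbitRel G X) y x := by rw [hr]; trivial
      exact this
  refine { htrans with isTrivialBlock_of_isBlock := fun {B} hB => ?_ }
  let r : Setoid X :=
    { r := fun x y => ∀ g : G, g • x ∈ B ↔ g • y ∈ B
      iseqv := ⟨fun _ _ => Iff.rfl, fun h g => (h g).symm, fun h k g => (h g).trans (k g)⟩ }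
  rcases h r (fun g hg x y hxy k => by
    simpa [mul_smul] using hxy (k * ⟨g, hg⟩)) with hr | hr
  · left
    intro x hx y hy
    have : r x y := by
      intro g
      have hb := MulAction.isBlock_iff_smul_eq_of_mem.mp hB
      constructor
      · intro hgx
        rw [← hb hx hgx]
        exact Set.smul_mem_smul_set hy
      · intro hgy
        rw [← hb hy hgy]
        exact Set.smul_mem_smul_set hx
    rw [hr] at this
    exact this
  · by_cases hB : ∃ x, x ∈ B
    · right
      obtain ⟨x, hx⟩ := hB
      refine Set.eq_univ_of_forall fun y => ?_
      have : r x y := by rw [hr]; trivial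
      simpa using (this 1).mp (by simpa using hx)
    · left
      intro x hx
      exact absurd ⟨x, hx⟩ hB

section Counting

/-- The action of a permutation group on the classes of an invariant equivalence relation. -/
def quotientPermHom {X : Type*} {G : Subgroup (Perm X)} (r : Setoid X)
    (hr : ∀ g ∈ G, ∀ x y, r x y → r (g x) (g y)) : G →* Perm (Quotient r) :=
  MonoidHom.toHomPerm
    { toFun := fun g => Quotient.map g.1 (hr g g.2)
      map_one' := funext (Quotient.ind fun _ => rfl)
      map_mul' := fun _ _ => funext (Quotient.ind fun _ => rfl) }

/-- The action on a class of an invariant equivalence relation of the elements fixing all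
classes. -/
def fiberPermHom {X : Type*} {G : Subgroup (Perm X)} (r : Setoid X)
    (hr : ∀ g ∈ G, ∀ x y, r x y → r (g x) (g y)) (q : Quotient r) :
    (quotientPermHom r hr).ker →* Perm {x // Quotient.mk r x = q} where
  toFun g := g.1.1.subtypePerm fun x => by
    have h : quotientPermHom r hr g.1 (Quotient.mk r x) = Quotient.mk r x := by
      rw [MonoidHom.mem_ker.mp g.2]; rfl
    exact (Eq.congr_left h)
  map_one' := rfl
  map_mul' _ _ := rfl

theorem card_le_of_invariant_setoid {X : Type*} [Fintype X] (G : Subgroup (Perm X))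
    (r : Setoid X)
    (hr : ∀ g ∈ G, ∀ x y, r x y → r (g x) (g y)) [Fintype (Quotient r)] :
    Nat.card G ≤ Nat.card (quotientPermHom r hr).range *
      ∏ q, Nat.card (fiberPermHom r hr q).range := by
  rw [← Subgroup.index_mul_card (quotientPermHom r hr).ker, Subgroup.index_ker]
  refine Nat.mul_le_mul_left _ ?_
  rw [← Nat.card_pi]
  refine Nat.card_le_card_of_injective
    (fun g q => (fiberPermHom r hr q).rangeRestrict g) fun g h hgh => ?_
  ext x
  have := congr_arg Subtype.val (congr_fun hgh (Quotient.mk r x))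
  exact congr_arg Subtype.val (Perm.ext_iff.mp this ⟨x, rfl⟩)

theorem card_le_choose_mul_card_stabilizer {X : Type*} [Fintype X] [DecidableEq X]
    (G : Subgroup (Perm X)) (S : Finset X) :
    Nat.card G ≤ (Fintype.card X).choose S.card * Nat.card (MulAction.stabilizer G S) := by
  rw [← Subgroup.index_mul_card (MulAction.stabilizer G S), MulAction.index_stabilizer]
  refine Nat.mul_le_mul_right _ ?_
  rw [← Finset.card_univ, ← Finset.card_powersetCard, ← Set.ncard_coe_finset]
  refine Set.ncard_le_ncard ?_ (Set.toFinite _)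
  rintro _ ⟨g, rfl⟩
  simp

/-- The action of the setwise stabilizer of `S` on `S`. -/
def stabilizerPermHom {X : Type*} [DecidableEq X] (G : Subgroup (Perm X)) (S : Finset X) :
    MulAction.stabilizer G S →* Perm {x // x ∈ S} where
  toFun g := g.1.1.subtypePerm fun x => by
    have h : g.1 • x ∈ g.1 • S ↔ x ∈ S := Finset.smul_mem_smul_finset_iff g.1
    rwa [MulAction.mem_stabilizer_iff.mp g.2] at h
  map_one' := rfl
  map_mul' _ _ := rfl

theorem stabilizerPermHom_injective {X : Type*} [DecidableEq X] (G : Subgroup (Perm X)) {S : Finset X}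
    (hS : ∀ g ∈ G, (∀ x ∈ S, g x = x) → g = 1) :
    Function.Injective (stabilizerPermHom G S) := by
  refine (injective_iff_map_eq_one _).mpr fun g hg => ?_
  refine Subtype.ext (Subtype.ext (hS _ g.1.2 fun x hx => ?_))
  exact congr_arg Subtype.val (Perm.ext_iff.mp hg ⟨x, hx⟩)

end Counting

section OrderBound

open scoped Nat

theorem card_le_of_invariant_setoid_of_forall {X : Type*} [Fintype X] [Nonempty X]
    {G : Subgroup (Perm X)} {r : Setoid X} (hr : ∀ g ∈ G, ∀ x y, r x y → r (g x) (g y)) {K : ℝ}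
    (hK : 0 ≤ K)
    (hquot : (Nat.card (quotientPermHom r hr).range : ℝ) ≤ K ^ (Nat.card (Quotient r) - 1))
    (hfiber : ∀ q, (Nat.card (fiberPermHom r hr q).range : ℝ) ≤
      K ^ (Nat.card {x // Quotient.mk r x = q} - 1)) :
    (Nat.card G : ℝ) ≤ K ^ (Nat.card X - 1) := by
  classical
  have hexp : Nat.card X - 1 = (Nat.card (Quotient r) - 1) +
      ∑ q : Quotient r, (Nat.card {x // Quotient.mk r x = q} - 1) := by
    have hsum : Nat.card X = ∑ q : Quotient r, Nat.card {x // Quotient.mk r x = q} := by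
      rw [← Nat.card_sigma]
      exact (Nat.card_congr (Equiv.sigmaFiberEquiv (Quotient.mk r))).symm
    have hsum' : ∑ q : Quotient r, Nat.card {x // Quotient.mk r x = q} =
        ∑ q : Quotient r, ((Nat.card {x // Quotient.mk r x = q} - 1) + 1) := by
      refine Finset.sum_congr rfl fun q _ => ?_
      obtain ⟨x, hx⟩ := q.exists_rep
      have : Nonempty {x // Quotient.mk r x = q} := ⟨⟨x, hx⟩⟩
      exact (Nat.sub_add_cancel Nat.card_pos).symm
    have : Nonempty (Quotient r) := ‹Nonempty X›.map (Quotient.mk r)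
    have hpos : 0 < Nat.card (Quotient r) := Nat.card_pos
    rw [hsum, hsum', Finset.sum_add_distrib]
    simp only [Finset.sum_const, Finset.card_univ, smul_eq_mul, mul_one,
      ← Nat.card_eq_fintype_card]
    omega
  calc (Nat.card G : ℝ)
      ≤ Nat.card (quotientPermHom r hr).range *
          ∏ q, (Nat.card (fiberPermHom r hr q).range : ℝ) := by
        exact_mod_cast card_le_of_invariant_setoid G r hr
    _ ≤ K ^ (Nat.card (Quotient r) - 1) *
          ∏ q : Quotient r, K ^ (Nat.card {x // Quotient.mk r x = q} - 1) := by
        gcongr with q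
        exact hfiber q
    _ = K ^ (Nat.card X - 1) := by
        rw [Finset.prod_pow_eq_pow_sum, ← pow_add, hexp]

/-- If `n! ≤ K ^ (n - 1)` for all `n < d`, then permutation groups of degree `n` without
alternating sections `A_d` have order at most `K ^ (n - 1)`. -/
theorem card_le_pow_of_inGamma {d : ℕ} {K : ℝ} (hK : 4 ≤ K)
    (hfact : ∀ n < d, (n ! : ℝ) ≤ K ^ (n - 1)) (X : Type*) [Fintype X]
    (G : Subgroup (Perm X)) (hG : InGamma d G) : (Nat.card G : ℝ) ≤ K ^ (Nat.card X - 1) := by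
  induction hn : Nat.card X using Nat.strong_induction_on generalizing X with
  | _ n ih =>
  subst hn
  classical
  have hK0 : 0 ≤ K := by linarith
  rcases lt_or_ge (Nat.card X) d with hXd | hXd
  · refine le_trans ?_ (hfact _ hXd)
    rw [← Nat.card_perm]
    exact_mod_cast Subgroup.card_le_card_group G
  by_cases hbot : G = ⊥
  · rw [hbot, Subgroup.card_bot, Nat.cast_one]
    exact one_le_pow₀ (by linarith)
  have hX : Nonempty X := by
    by_contra h
    rw [not_nonempty_iff] at h
    exact hbot (Subgroup.eq_bot_of_subsingleton G)
  by_cases hr : ∀ r : Setoid X, (∀ g ∈ G, ∀ x y, r x y → r (g x) (g y)) → r = ⊥ ∨ r = ⊤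
  · have hprim := isPreprimitive_of_invariant_setoid G hbot hr
    obtain ⟨S, hScard, hS⟩ := exists_base_of_isPreprimitive hprim
      (hG.not_alternatingGroup_le (by rwa [← Nat.card_eq_fintype_card]))
    rw [← Nat.card_eq_fintype_card] at hScard
    rcases S.eq_empty_or_nonempty with hempty | hne
    · exact absurd ((Subgroup.eq_bot_iff_forall G).mpr fun g hg => hS g hg (by simp [hempty])) hbot
    have hpos := hne.card_pos
    have hstab := ih S.card (by omega) {x // x ∈ S} (stabilizerPermHom G S).range
      ((hG.of_injective _ (MulAction.stabilizer G S).subtype_injective).range _) (by simp)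
    rw [← Nat.card_congr (MonoidHom.ofInjective (stabilizerPermHom_injective G hS)).toEquiv]
      at hstab
    calc (Nat.card G : ℝ)
        ≤ (Fintype.card X).choose S.card * Nat.card (MulAction.stabilizer G S) := by
          exact_mod_cast card_le_choose_mul_card_stabilizer G S
      _ ≤ 2 ^ Nat.card X * K ^ (S.card - 1) := by
          gcongr
          rw [← Nat.card_eq_fintype_card]
          exact_mod_cast Nat.choose_le_two_pow _ _
      _ ≤ 4 ^ (Nat.card X - S.card) * K ^ (S.card - 1) := by
          gcongr
          rw [show (4 : ℝ) = 2 ^ 2 by norm_num, ← pow_mul]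
          exact pow_le_pow_right₀ (by norm_num) (by omega)
      _ ≤ K ^ (Nat.card X - S.card) * K ^ (S.card - 1) := by gcongr
      _ = K ^ (Nat.card X - 1) := by
          rw [← pow_add]
          congr 1
          omega
  · push Not at hr
    obtain ⟨r, hr, hrbot, hrtop⟩ := hr
    refine card_le_of_invariant_setoid_of_forall hr hK0 ?_ fun q => ?_
    · refine ih _ ?_ (Quotient r) _ (hG.range _) rfl
      simp only [Nat.card_eq_fintype_card]
      refine Fintype.card_lt_of_surjective_not_injective _ Quotient.mk_surjective fun hinj => ?_
      exact hrbot (Setoid.ext fun x y =>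
        ⟨fun h => hinj (Quotient.sound h), fun h => h ▸ r.refl x⟩)
    · refine ih _ ?_ {x // Quotient.mk r x = q} _
        ((hG.of_injective _ (Subgroup.subtype_injective _)).range _) rfl
      simp only [Nat.card_eq_fintype_card]
      obtain ⟨x, hx⟩ : ∃ x, Quotient.mk r x ≠ q := by
        by_contra! h
        exact hrtop (Setoid.ext fun x y =>
          ⟨fun _ => trivial, fun _ => Quotient.exact ((h x).trans (h y).symm)⟩)
      exact Fintype.card_subtype_lt hx

end OrderBound

section Factorial

open scoped Nat
open Filter

theorem factorial_succ_mul_exp_le (n : ℕ) :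
    ((n + 1)! : ℝ) * Real.exp 1 ^ n ≤ (n + 1 : ℝ) ^ (n + 2) := by
  induction n with
  | zero => simp
  | succ n ih =>
    have hn : (0 : ℝ) < n + 2 := by positivity
    have hexp : Real.exp 1 * (n + 1 : ℝ) ^ (n + 2) ≤ (n + 2 : ℝ) ^ (n + 2) := by
      have h := Real.one_sub_div_pow_le_exp_neg (n := n + 2) (t := 1) (by push_cast; linarith)
      rw [Real.exp_neg, show (1 - 1 / ((n + 2 : ℕ) : ℝ)) = (n + 1) / (n + 2) by
        push_cast; field_simp; ring, div_pow, div_le_iff₀ (by positivity)] at h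
      calc Real.exp 1 * (n + 1 : ℝ) ^ (n + 2)
          ≤ Real.exp 1 * ((Real.exp 1)⁻¹ * (n + 2 : ℝ) ^ (n + 2)) := by gcongr
        _ = (n + 2 : ℝ) ^ (n + 2) := by
          rw [← mul_assoc, mul_inv_cancel₀ (Real.exp_ne_zero 1), one_mul]
    calc ((n + 1 + 1)! : ℝ) * Real.exp 1 ^ (n + 1)
        = (n + 2) * Real.exp 1 * ((n + 1)! * Real.exp 1 ^ n) := by
          rw [Nat.factorial_succ (n + 1)]
          push_cast
          ring
      _ ≤ (n + 2) * Real.exp 1 * (n + 1 : ℝ) ^ (n + 2) := by gcongr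
      _ = (n + 2) * (Real.exp 1 * (n + 1 : ℝ) ^ (n + 2)) := by ring
      _ ≤ (n + 2) * (n + 2 : ℝ) ^ (n + 2) := by gcongr
      _ = ((n + 1 : ℕ) + 1 : ℝ) ^ (n + 1 + 2) := by
          push_cast
          ring

theorem eventually_pow_le_pow_pred {a : ℝ} (ha : 1 < a) (k : ℕ) :
    ∀ᶠ n : ℕ in atTop, (n : ℝ) ^ k ≤ a ^ (n - 1) := by
  have h := (tendsto_pow_const_div_const_pow_of_one_lt k ha).eventually_le_const
    (inv_pos.mpr (zero_lt_one.trans ha))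
  filter_upwards [h, eventually_ge_atTop 1] with n hn hn1
  have ha0 : 0 < a := zero_lt_one.trans ha
  rw [div_le_iff₀ (by positivity)] at hn
  refine hn.trans_eq ?_
  obtain ⟨m, rfl⟩ := Nat.exists_eq_add_of_le' hn1
  rw [Nat.add_sub_cancel, pow_succ]
  field_simp

theorem eventually_factorial_le {η : ℝ} (hη : 0 < η) :
    ∀ᶠ d : ℕ in atTop, ∀ n ≤ d, (n ! : ℝ) ≤ ((1 + η) * d / Real.exp 1) ^ (n - 1) := by
  obtain ⟨n₀, hn₀⟩ := eventually_atTop.mp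
    (eventually_pow_le_pow_pred (a := 1 + η) (by linarith) 2)
  have hlim : Tendsto (fun d : ℕ => (1 + η) * d / Real.exp 1) atTop atTop :=
    (tendsto_natCast_atTop_atTop.const_mul_atTop (by linarith)).atTop_div_const (Real.exp_pos 1)
  filter_upwards [hlim.eventually_ge_atTop (n₀ ! : ℝ)] with d hd n hnd
  have hK1 : 1 ≤ (1 + η) * d / Real.exp 1 :=
    le_trans (by exact_mod_cast Nat.one_le_iff_ne_zero.mpr n₀.factorial_ne_zero) hd
  rcases Nat.lt_or_ge n 2 with hn2 | hn2
  · have : n ! = 1 := by interval_cases n <;> rfl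
    rw [this, Nat.cast_one]
    exact one_le_pow₀ hK1
  rcases Nat.le_total n n₀ with hn | hn
  · calc (n ! : ℝ) ≤ n₀ ! := by exact_mod_cast Nat.factorial_le hn
      _ ≤ (1 + η) * d / Real.exp 1 := hd
      _ ≤ _ := le_self_pow₀ hK1 (by omega)
  · obtain ⟨m, rfl⟩ := Nat.exists_eq_add_of_le' (Nat.one_le_of_lt hn2)
    have hsq := hn₀ _ hn
    have hfac := factorial_succ_mul_exp_le m
    rw [Nat.add_sub_cancel] at hsq ⊢
    rw [div_pow, le_div_iff₀ (by positivity)]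
    calc ((m + 1)! : ℝ) * Real.exp 1 ^ m
        ≤ (m + 1 : ℝ) ^ (m + 2) := hfac
      _ = ((m + 1 : ℕ) : ℝ) ^ 2 * ((m + 1 : ℕ) : ℝ) ^ m := by
          push_cast
          ring
      _ ≤ (1 + η) ^ m * (d : ℝ) ^ m := by gcongr
      _ = ((1 + η) * d) ^ m := by rw [mul_pow]

end Factorial

/-- **Corollary 3(iii).** For every `c ≥ 0` and `δ > 0` there is `N(c,δ)` such that for all
`d ≥ N(c,δ)`: if `G ≤ Sym(Ω)` has degree `n` and the setwise stabilizer `G_Δ` of every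
`c`-element subset `Δ ⊆ Ω` lies in `Γ_d`, then `|G| ≤ ((1+δ)d/e)^{n-1}`.  (Here the setwise
stabilizer is the stabilizer of `Δ : Finset Ω` under the induced action of `G` on subsets.) -/
theorem order_le_of_setwise_stabilizers_in_gamma (c : ℕ) (δ : ℝ) (hδ : 0 < δ) :
    ∃ N : ℕ, ∀ d : ℕ, N ≤ d → ∀ (Ω : Type) [Fintype Ω] [DecidableEq Ω],
      ∀ G : Subgroup (Equiv.Perm Ω),
        (∀ Δ : Finset Ω, Δ.card = c → InGamma d ↥(MulAction.stabilizer (↥G) Δ)) →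
        (Nat.card ↥G : ℝ) ≤ ((1 + δ) * d / Real.exp 1) ^ (Fintype.card Ω - 1) := by
  classical
  have hη : 0 < δ / 2 := by linarith
  have hratio : 1 < (1 + δ) / (1 + δ / 2) := by
    rw [one_lt_div (by linarith)]
    linarith
  have hlim : Filter.Tendsto (fun d : ℕ => (1 + δ / 2) * d / Real.exp 1) Filter.atTop
      Filter.atTop :=
    (tendsto_natCast_atTop_atTop.const_mul_atTop (by linarith)).atTop_div_const (Real.exp_pos 1)
  obtain ⟨n₀, hn₀⟩ := Filter.eventually_atTop.mp (eventually_pow_le_pow_pred hratio c)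
  obtain ⟨N, hN⟩ := Filter.eventually_atTop.mp <|
    (eventually_factorial_le hη).and <| (eventually_factorial_le hδ).and <|
      (hlim.eventually_ge_atTop 4).and (Filter.eventually_ge_atTop (max c n₀))
  refine ⟨N, fun d hd Ω _ _ G hG => ?_⟩
  obtain ⟨hfact, hfact', hK, hdmax⟩ := hN d hd
  rcases Nat.le_total (Fintype.card Ω) d with hΩ | hΩ
  · refine le_trans ?_ (hfact' _ hΩ)
    rw [← Nat.card_eq_fintype_card, ← Nat.card_perm]
    exact_mod_cast Subgroup.card_le_card_group G
  obtain ⟨Δ, -, hΔ⟩ := Finset.exists_subset_card_eq (s := (Finset.univ : Finset Ω)) (n := c)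
    (by rw [Finset.card_univ]; omega)
  have hstab := card_le_pow_of_inGamma hK (fun n hn => hfact n hn.le) Ω _
    ((hG Δ hΔ).range (G.subtype.comp (MulAction.stabilizer G Δ).subtype))
  rw [← Nat.card_congr (MonoidHom.ofInjective (Subtype.val_injective.comp
    Subtype.val_injective)).toEquiv, Nat.card_eq_fintype_card (α := Ω)] at hstab
  have hpow : ((Fintype.card Ω).choose c : ℝ) ≤
      ((1 + δ) / (1 + δ / 2)) ^ (Fintype.card Ω - 1) :=
    le_trans (by exact_mod_cast Nat.choose_le_pow _ _) (hn₀ _ (by omega))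
  calc (Nat.card G : ℝ)
      ≤ (Fintype.card Ω).choose c * Nat.card (MulAction.stabilizer G Δ) := by
        rw [← hΔ]
        exact_mod_cast card_le_choose_mul_card_stabilizer G Δ
    _ ≤ ((1 + δ) / (1 + δ / 2)) ^ (Fintype.card Ω - 1) *
          ((1 + δ / 2) * d / Real.exp 1) ^ (Fintype.card Ω - 1) := by gcongr
    _ = ((1 + δ) * d / Real.exp 1) ^ (Fintype.card Ω - 1) := by
        rw [← mul_pow]
        congr 1
        field_simp
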